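/- arXiv:2405.12001 — 2 statements merged into one kernel-verified Lean document; each statement's English description precedes it below -/
import Mathlib

section
/- Let π₁ and π₂ be two L_z-Lipschitz policy families with L_z > 0, assume R_max > 0, and let Z₁, Z₂, Z_mut : I → E be assignments of task representations. Set κ = 2 R_max / (1−γ)² and ε = J(π₂, Z_mut) − J(π₁, Z_mut). If for every i ∈ I one has dist(Z₂(i), Z_mut(i)) ≤ ε / (2 κ L_z) − (1/2)·dist(Z₂(i), Z₁(i)), then J(π₂, Z₂) − J(π₁, Z₁) ≥ 0 (monotonic performance improvement is achieved by reining the task representation shift). -/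
open scoped BigOperators

/-- Total variation distance between two PMFs on a finite type. -/
noncomputable def DTV {α : Type*} [Fintype α] (p q : PMF α) : ℝ :=
  (1 / 2) * ∑ x, |(p x).toReal - (q x).toReal|

/-- The time-`t` state–action distribution of policy `π` in the MDP with transition
kernel `P` and initial state distribution `ρ₀`. -/
noncomputable def stateActionDist {S A : Type*} (π : S → PMF A) (P : S × A → PMF S)
    (ρ₀ : PMF S) : ℕ → PMF (S × A)
  | 0 => ρ₀.bind fun s => (π s).map fun a => (s, a)
  | (t + 1) => (stateActionDist π P ρ₀ t).bind fun sa =>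
      (P sa).bind fun s' => (π s').map fun a' => (s', a')

/-- The expected discounted return of policy `π` under transition kernel `P`,
initial distribution `ρ₀`, discount `γ` and reward `R`. -/
noncomputable def Vret {S A : Type*} [Fintype S] [Fintype A] (π : S → PMF A)
    (P : S × A → PMF S) (ρ₀ : PMF S) (γ : ℝ) (R : S × A → ℝ) : ℝ :=
  ∑' t : ℕ, γ ^ t * ∑ sa : S × A, ((stateActionDist π P ρ₀ t) sa).toReal * R sa

/-- The task-averaged expected return of policy family `π` conditioned on the
task representation assignment `ζ`. -/
noncomputable def Jret {S A E I : Type*} [Fintype S] [Fintype A] [Fintype I]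
    (π : S → E → PMF A) (ζ : I → E) (P : I → S × A → PMF S) (R : I → S × A → ℝ)
    (ρ₀ : PMF S) (γ : ℝ) (w : I → ℝ) : ℝ :=
  ∑ i, w i * Vret (fun s => π s (ζ i)) (P i) ρ₀ γ (R i)

theorem PMF.sum_toReal {α : Type*} [Fintype α] (p : PMF α) : ∑ x, (p x).toReal = 1 := by
  rw [← ENNReal.toReal_sum fun x _ => p.apply_ne_top x,
    ← tsum_fintype (L := .unconditional α), p.tsum_coe, ENNReal.toReal_one]

theorem PMF.toReal_bind_apply {α β : Type*} [Fintype α] (p : PMF α) (f : α → PMF β) (b : β) :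
    (p.bind f b).toReal = ∑ x, (p x).toReal * (f x b).toReal := by
  rw [PMF.bind_apply, tsum_fintype, ENNReal.toReal_sum fun x _ =>
    ENNReal.mul_ne_top (p.apply_ne_top x) ((f x).apply_ne_top b)]
  simp only [ENNReal.toReal_mul]

theorem DTV_self {α : Type*} [Fintype α] (p : PMF α) : DTV p p = 0 := by simp [DTV]

theorem DTV_bind_le {α β : Type*} [Fintype α] [Fintype β] (p q : PMF α) (f g : α → PMF β)
    {c : ℝ} (h : ∀ x, DTV (f x) (g x) ≤ c) :
    DTV (p.bind f) (q.bind g) ≤ DTV p q + c := by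
  have hpoint : ∀ b, |(p.bind f b).toReal - (q.bind g b).toReal| ≤
      ∑ x, (|(p x).toReal - (q x).toReal| * (f x b).toReal +
        (q x).toReal * |(f x b).toReal - (g x b).toReal|) := by
    intro b
    rw [PMF.toReal_bind_apply, PMF.toReal_bind_apply, ← Finset.sum_sub_distrib]
    refine (Finset.abs_sum_le_sum_abs _ _).trans (Finset.sum_le_sum fun x _ => ?_)
    calc |(p x).toReal * (f x b).toReal - (q x).toReal * (g x b).toReal|
        = |((p x).toReal - (q x).toReal) * (f x b).toReal +
            (q x).toReal * ((f x b).toReal - (g x b).toReal)| := by congr 1; ring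
      _ ≤ _ := (abs_add_le _ _).trans_eq (by
          rw [abs_mul, abs_mul, abs_of_nonneg (ENNReal.toReal_nonneg (a := f x b)),
            abs_of_nonneg (ENNReal.toReal_nonneg (a := q x))])
  have hsum : ∑ b, |(p.bind f b).toReal - (q.bind g b).toReal| ≤
      ∑ x, |(p x).toReal - (q x).toReal| + 2 * c := by
    calc _ ≤ ∑ b, ∑ x, (|(p x).toReal - (q x).toReal| * (f x b).toReal +
            (q x).toReal * |(f x b).toReal - (g x b).toReal|) :=
          Finset.sum_le_sum fun b _ => hpoint b
      _ = ∑ x, (|(p x).toReal - (q x).toReal| + (q x).toReal * (2 * DTV (f x) (g x))) := by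
          rw [Finset.sum_comm]
          refine Finset.sum_congr rfl fun x _ => ?_
          rw [Finset.sum_add_distrib, ← Finset.mul_sum, ← Finset.mul_sum, PMF.sum_toReal, DTV]
          ring
      _ ≤ ∑ x, (|(p x).toReal - (q x).toReal| + (q x).toReal * (2 * c)) := by
          gcongr with x
          exact h x
      _ = _ := by rw [Finset.sum_add_distrib, ← Finset.sum_mul, PMF.sum_toReal, one_mul]
  unfold DTV
  linarith

theorem DTV_map_le {α β : Type*} [Fintype α] [Fintype β] (p q : PMF α) (f : α → β) :
    DTV (p.map f) (q.map f) ≤ DTV p q := by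
  simpa [PMF.map] using DTV_bind_le p q (PMF.pure ∘ f) (PMF.pure ∘ f) fun x => (DTV_self _).le

theorem DTV_stateActionDist_le {S A : Type*} [Fintype S] [Fintype A] (π π' : S → PMF A)
    (P : S × A → PMF S) (ρ₀ : PMF S) {δ : ℝ} (h : ∀ s, DTV (π s) (π' s) ≤ δ) (t : ℕ) :
    DTV (stateActionDist π P ρ₀ t) (stateActionDist π' P ρ₀ t) ≤ (t + 1) * δ := by
  have hstep : ∀ s, DTV ((π s).map fun a => (s, a)) ((π' s).map fun a => (s, a)) ≤ δ :=
    fun s => (DTV_map_le _ _ _).trans (h s)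
  induction t with
  | zero =>
    simpa [stateActionDist, DTV_self] using DTV_bind_le ρ₀ ρ₀ _ _ hstep
  | succ t ih =>
    have hnext : ∀ sa, DTV ((P sa).bind fun s' => (π s').map fun a' => (s', a'))
        ((P sa).bind fun s' => (π' s').map fun a' => (s', a')) ≤ δ := fun sa => by
      simpa [DTV_self] using DTV_bind_le (P sa) (P sa) _ _ hstep
    have := DTV_bind_le (stateActionDist π P ρ₀ t) (stateActionDist π' P ρ₀ t) _ _ hnext
    simp only [stateActionDist]
    push_cast
    linarith

theorem abs_expectation_le {α : Type*} [Fintype α] (p : PMF α) (R : α → ℝ) {B : ℝ}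
    (hR : ∀ x, |R x| ≤ B) : |∑ x, (p x).toReal * R x| ≤ B := by
  calc _ ≤ ∑ x, |(p x).toReal * R x| := Finset.abs_sum_le_sum_abs _ _
    _ ≤ ∑ x, (p x).toReal * B := by
        refine Finset.sum_le_sum fun x _ => ?_
        rw [abs_mul, abs_of_nonneg ENNReal.toReal_nonneg]
        exact mul_le_mul_of_nonneg_left (hR x) ENNReal.toReal_nonneg
    _ = B := by rw [← Finset.sum_mul, PMF.sum_toReal, one_mul]

theorem abs_expectation_sub_le {α : Type*} [Fintype α] (p q : PMF α) (R : α → ℝ) {B : ℝ}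
    (hR : ∀ x, |R x| ≤ B) :
    |∑ x, (p x).toReal * R x - ∑ x, (q x).toReal * R x| ≤ 2 * B * DTV p q := by
  rw [← Finset.sum_sub_distrib]
  calc _ ≤ ∑ x, |(p x).toReal * R x - (q x).toReal * R x| := Finset.abs_sum_le_sum_abs _ _
    _ ≤ ∑ x, |(p x).toReal - (q x).toReal| * B := by
        refine Finset.sum_le_sum fun x _ => ?_
        rw [← sub_mul, abs_mul]
        exact mul_le_mul_of_nonneg_left (hR x) (abs_nonneg _)
    _ = 2 * B * DTV p q := by rw [← Finset.sum_mul, DTV]; ring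

theorem hasSum_succ_mul_geometric {γ : ℝ} (hγ0 : 0 ≤ γ) (hγ1 : γ < 1) :
    HasSum (fun t : ℕ => ((t : ℝ) + 1) * γ ^ t) (1 / (1 - γ) ^ 2) := by
  simpa using hasSum_choose_mul_geometric_of_norm_lt_one 1
    (by rwa [Real.norm_of_nonneg hγ0] : ‖γ‖ < 1)

theorem summable_discounted_reward {S A : Type*} [Fintype S] [Fintype A] (π : S → PMF A)
    (P : S × A → PMF S) (ρ₀ : PMF S) {γ : ℝ} (hγ0 : 0 ≤ γ) (hγ1 : γ < 1) (R : S × A → ℝ)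
    {B : ℝ} (hR : ∀ sa, |R sa| ≤ B) :
    Summable fun t : ℕ => γ ^ t * ∑ sa : S × A, ((stateActionDist π P ρ₀ t) sa).toReal * R sa := by
  refine Summable.of_norm_bounded ((summable_geometric_of_lt_one hγ0 hγ1).mul_right B) fun t => ?_
  rw [Real.norm_eq_abs, abs_mul, abs_of_nonneg (pow_nonneg hγ0 t)]
  exact mul_le_mul_of_nonneg_left (abs_expectation_le _ R hR) (pow_nonneg hγ0 t)

theorem abs_Vret_sub_le {S A : Type*} [Fintype S] [Fintype A] (π π' : S → PMF A)
    (P : S × A → PMF S) (ρ₀ : PMF S) {γ : ℝ} (hγ0 : 0 ≤ γ) (hγ1 : γ < 1) (R : S × A → ℝ)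
    {B : ℝ} (hB : 0 ≤ B) (hR : ∀ sa, |R sa| ≤ B) {δ : ℝ} (h : ∀ s, DTV (π s) (π' s) ≤ δ) :
    |Vret π P ρ₀ γ R - Vret π' P ρ₀ γ R| ≤ 2 * B / (1 - γ) ^ 2 * δ := by
  unfold Vret
  rw [← (summable_discounted_reward π P ρ₀ hγ0 hγ1 R hR).tsum_sub
    (summable_discounted_reward π' P ρ₀ hγ0 hγ1 R hR), ← Real.norm_eq_abs]
  have hsum := (hasSum_succ_mul_geometric hγ0 hγ1).mul_left (2 * B * δ)
  rw [show 2 * B * δ * (1 / (1 - γ) ^ 2) = 2 * B / (1 - γ) ^ 2 * δ by ring] at hsum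
  refine tsum_of_norm_bounded hsum fun t => ?_
  rw [← mul_sub, Real.norm_eq_abs, abs_mul, abs_of_nonneg (pow_nonneg hγ0 t)]
  calc _ ≤ γ ^ t * (2 * B * ((t + 1) * δ)) := by
        refine mul_le_mul_of_nonneg_left ((abs_expectation_sub_le _ _ R hR).trans ?_)
          (pow_nonneg hγ0 t)
        exact mul_le_mul_of_nonneg_left (DTV_stateActionDist_le π π' P ρ₀ h t) (by positivity)
    _ = _ := by ring

theorem abs_Jret_sub_le {S A E I : Type*} [Fintype S] [Fintype A] [MetricSpace E] [Fintype I]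
    (ρ₀ : PMF S) {γ : ℝ} (hγ0 : 0 ≤ γ) (hγ1 : γ < 1) {w : I → ℝ} (hw0 : ∀ i, 0 ≤ w i)
    (P : I → S × A → PMF S) (R : I → S × A → ℝ) {B : ℝ} (hB : 0 ≤ B)
    (hR : ∀ i sa, |R i sa| ≤ B) {L : ℝ} (π : S → E → PMF A)
    (hLip : ∀ s z z', DTV (π s z) (π s z') ≤ L * dist z z') (ζ ζ' : I → E) :
    |Jret π ζ P R ρ₀ γ w - Jret π ζ' P R ρ₀ γ w| ≤
      ∑ i, w i * (2 * B / (1 - γ) ^ 2 * (L * dist (ζ i) (ζ' i))) := by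
  unfold Jret
  rw [← Finset.sum_sub_distrib]
  refine (Finset.abs_sum_le_sum_abs _ _).trans (Finset.sum_le_sum fun i _ => ?_)
  rw [← mul_sub, abs_mul, abs_of_nonneg (hw0 i)]
  exact mul_le_mul_of_nonneg_left
    (abs_Vret_sub_le _ _ (P i) ρ₀ hγ0 hγ1 (R i) hB (hR i) fun s => hLip s _ _) (hw0 i)

/-- **Monotonic performance improvement by reining the task representation shift**
(consequence of Theorem 3 via Eq. (13)). -/
theorem monotonic_improvement_by_reining_shift
    {S A : Type*} [Fintype S] [Nonempty S] [Fintype A] [Nonempty A]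
    {E : Type*} [MetricSpace E] {I : Type*} [Fintype I]
    (ρ₀ : PMF S) (γ : ℝ) (hγ0 : 0 ≤ γ) (hγ1 : γ < 1)
    (w : I → ℝ) (hw0 : ∀ i, 0 ≤ w i) (hw1 : ∑ i, w i = 1)
    (P : I → S × A → PMF S) (R : I → S × A → ℝ)
    (Rmax : ℝ) (hRmax : 0 < Rmax) (hR : ∀ i sa, |R i sa| ≤ Rmax)
    (Lz : ℝ) (hLz : 0 < Lz)
    (π₁ π₂ : S → E → PMF A)
    (hLip1 : ∀ s z z', DTV (π₁ s z) (π₁ s z') ≤ Lz * dist z z')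
    (hLip2 : ∀ s z z', DTV (π₂ s z) (π₂ s z') ≤ Lz * dist z z')
    (Z₁ Z₂ Zmut : I → E)
    (hcond : ∀ i, dist (Z₂ i) (Zmut i) ≤
      (Jret π₂ Zmut P R ρ₀ γ w - Jret π₁ Zmut P R ρ₀ γ w) /
          (2 * (2 * Rmax / (1 - γ) ^ 2) * Lz) -
        (1 / 2) * dist (Z₂ i) (Z₁ i)) :
    Jret π₂ Z₂ P R ρ₀ γ w - Jret π₁ Z₁ P R ρ₀ γ w ≥ 0 := by
  have h₁ := (abs_le.1 (abs_Jret_sub_le ρ₀ hγ0 hγ1 hw0 P R hRmax.le hR π₁ hLip1 Z₁ Zmut)).2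
  have h₂ := (abs_le.1 (abs_Jret_sub_le ρ₀ hγ0 hγ1 hw0 P R hRmax.le hR π₂ hLip2 Z₂ Zmut)).1
  set ε := Jret π₂ Zmut P R ρ₀ γ w - Jret π₁ Zmut P R ρ₀ γ w with hε
  set κ := 2 * Rmax / (1 - γ) ^ 2 with hκ
  have hκ_pos : 0 < κ := div_pos (by positivity) (pow_pos (sub_pos.2 hγ1) 2)
  have hbound : ∑ i, w i * (κ * (Lz * dist (Z₁ i) (Zmut i))) +
      ∑ i, w i * (κ * (Lz * dist (Z₂ i) (Zmut i))) ≤ ε := by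
    rw [← Finset.sum_add_distrib]
    calc _ ≤ ∑ i, w i * ε := by
          refine Finset.sum_le_sum fun i _ => ?_
          rw [← mul_add]
          refine mul_le_mul_of_nonneg_left ?_ (hw0 i)
          have htri := dist_triangle_left (Z₁ i) (Zmut i) (Z₂ i)
          have hdist : dist (Z₁ i) (Zmut i) + dist (Z₂ i) (Zmut i) ≤
              2 * (ε / (2 * κ * Lz)) := by
            linarith [hcond i]
          calc _ = κ * Lz * (dist (Z₁ i) (Zmut i) + dist (Z₂ i) (Zmut i)) := by ring
            _ ≤ κ * Lz * (2 * (ε / (2 * κ * Lz))) :=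
                mul_le_mul_of_nonneg_left hdist (by positivity)
            _ = ε := by field_simp
      _ = ε := by rw [← Finset.sum_mul, hw1, one_mul]
  linarith
end

section
/- Let 𝒜 be a finite set with |𝒜| = a ≥ 2, let P be a probability mass function on 𝒜, let P̂ be the empirical distribution of m ≥ 1 independent samples drawn from P, and let ξ ∈ (0,1]. Then with probability at least 1 − ξ, ‖P̂ − P‖₁ ≤ sqrt( (2/m) · log((2^a − 2)/ξ) ). -/
open scoped BigOperators Classical
open MeasureTheory

/-- The empirical distribution of the samples `x : Fin m → 𝒜`. -/
noncomputable def empDist {𝒜 : Type*} [Fintype 𝒜] {m : ℕ} (x : Fin m → 𝒜) (j : 𝒜) : ℝ :=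
  (∑ i, if x i = j then (1 : ℝ) else 0) / m

theorem PMF.sum_toReal_eq_one {α : Type*} [Fintype α] (P : PMF α) :
    ∑ j, (P j).toReal = 1 := by
  rw [← ENNReal.toReal_sum fun j _ => P.apply_ne_top j, ← tsum_fintype (L := .unconditional α),
    P.tsum_coe, ENNReal.toReal_one]

theorem sum_empDist_finset {α : Type*} [Fintype α] {m : ℕ} (x : Fin m → α) (S : Finset α) :
    ∑ j ∈ S, empDist x j = (∑ i, if x i ∈ S then (1 : ℝ) else 0) / m := by
  simp only [empDist, ← Finset.sum_div]
  rw [Finset.sum_comm]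
  simp only [Finset.sum_ite_eq]

theorem sum_empDist {α : Type*} [Fintype α] {m : ℕ} (hm : m ≠ 0) (x : Fin m → α) :
    ∑ j, empDist x j = 1 := by
  rw [sum_empDist_finset]
  simp [hm]

/-- A finite family summing to zero has a proper nonempty subfamily
carrying half of its `ℓ¹` norm. -/
theorem exists_finset_half_l1_le_sum {α : Type*} [Fintype α] (d : α → ℝ) (hd : ∑ j, d j = 0)
    (hpos : 0 < ∑ j, |d j|) :
    ∃ S : Finset α, S ≠ ∅ ∧ S ≠ Finset.univ ∧ (∑ j, |d j|) / 2 ≤ ∑ j ∈ S, d j := by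
  have h : ∑ j with 0 < d j, d j = (∑ j, |d j|) / 2 := by
    have h2 : ∑ j, (|d j| + d j) = 2 * ∑ j with 0 < d j, d j := by
      rw [Finset.sum_filter, Finset.mul_sum]
      refine Finset.sum_congr rfl fun j _ => ?_
      split_ifs with hj
      · rw [abs_of_pos hj]; ring
      · rw [abs_of_nonpos (not_lt.1 hj)]; ring
    rw [Finset.sum_add_distrib, hd] at h2
    linarith
  refine ⟨_, ?_, ?_, h.ge⟩ <;> intro hS <;> rw [hS] at h
  · rw [Finset.sum_empty] at h
    linarith
  · rw [hd] at h
    linarith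

open ProbabilityTheory in
/-- **Hoeffding's inequality** for the empirical measure of a fixed set. -/
theorem measureReal_le_sum_empDist_sub_le {α : Type*} [Fintype α] [MeasurableSpace α]
    [MeasurableSingletonClass α] (P : PMF α) {m : ℕ} (hm : m ≠ 0) (S : Finset α) {ε : ℝ}
    (hε : 0 ≤ ε) :
    (Measure.pi fun _ : Fin m => P.toMeasure).real
      {x | ε ≤ ∑ j ∈ S, (empDist x j - (P j).toReal)} ≤ Real.exp (-(2 * m * ε ^ 2)) := by
  have hm' : (0 : ℝ) < m := by positivity
  set f : α → ℝ := fun j => if j ∈ S then 1 else 0 with hf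
  have hfm : Measurable f := measurable_of_finite f
  have hint : ∫ j, f j ∂P.toMeasure = ∑ j ∈ S, (P j).toReal := by
    rw [PMF.integral_eq_sum]
    simp [hf]
  set X : α → ℝ := fun j => f j - ∫ k, f k ∂P.toMeasure with hX
  have hsub : HasSubgaussianMGF X ((‖(1 : ℝ) - 0‖₊ / 2) ^ 2) P.toMeasure := by
    refine hasSubgaussianMGF_of_mem_Icc hfm.aemeasurable (ae_of_all _ fun j => ?_)
    simp only [hf]
    split_ifs <;> simp
  have hindep : iIndepFun (fun (i : Fin m) x => X (x i))
      (Measure.pi fun _ : Fin m => P.toMeasure) :=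
    iIndepFun_pi fun _ => (measurable_of_finite X).aemeasurable
  have hsubi : ∀ i ∈ (Finset.univ : Finset (Fin m)),
      HasSubgaussianMGF (fun x : Fin m → α => X (x i)) ((‖(1 : ℝ) - 0‖₊ / 2) ^ 2)
        (Measure.pi fun _ : Fin m => P.toMeasure) := fun i _ => by
    have hp := measurePreserving_eval (fun _ : Fin m => P.toMeasure) i
    refine HasSubgaussianMGF.of_map (X := X) hp.measurable.aemeasurable ?_
    rwa [hp.map_eq]
  have key := HasSubgaussianMGF.measure_sum_ge_le_of_iIndepFun hindep hsubi
    (mul_nonneg hm'.le hε)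
  have hsum (x : Fin m → α) :
      ∑ i, X (x i) = m * ∑ j ∈ S, (empDist x j - (P j).toReal) := by
    rw [Finset.sum_sub_distrib (empDist x), sum_empDist_finset, mul_sub, mul_div_cancel₀ _ hm'.ne', ← hint]
    simp [hX, hf]
  simp only [hsum, mul_le_mul_iff_right₀ hm'] at key
  refine key.trans_eq ?_
  congr 1
  simp
  field_simp

theorem card_filter_ne_empty_ne_univ {α : Type*} [Fintype α] (h : 1 ≤ Fintype.card α) :
    (({S | S ≠ ∅ ∧ S ≠ Finset.univ} : Finset (Finset α)).card : ℝ) =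
      2 ^ Fintype.card α - 2 := by
  have hne : (∅ : Finset α) ≠ Finset.univ := by
    rintro hS
    rw [← Finset.card_univ, ← hS] at h
    simp at h
  have hS : ({S | S ≠ ∅ ∧ S ≠ Finset.univ} : Finset (Finset α)) = {∅, Finset.univ}ᶜ := by
    ext S
    simp
  have h2 : 2 ≤ 2 ^ Fintype.card α := by simpa using Nat.pow_le_pow_right two_pos h
  rw [hS, Finset.card_compl, Finset.card_pair hne, Fintype.card_finset, Nat.cast_sub h2]
  simp

/-- With probability at least `1 - ξ`, the L1 deviation of the empirical distribution
of `m` i.i.d. samples from `P` is at most `sqrt((2/m) · log((2^a − 2)/ξ))`. -/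
theorem empirical_l1_deviation_high_prob
    {𝒜 : Type*} [Fintype 𝒜] [MeasurableSpace 𝒜] [MeasurableSingletonClass 𝒜]
    (a : ℕ) (ha : Fintype.card 𝒜 = a) (ha2 : 2 ≤ a) (P : PMF 𝒜)
    (m : ℕ) (hm : 1 ≤ m) (ξ : ℝ) (hξ0 : 0 < ξ) (hξ1 : ξ ≤ 1) :
    1 - ξ ≤ ((Measure.pi fun _ : Fin m => P.toMeasure)
        {x | ∑ j, |empDist x j - (P j).toReal| ≤
          Real.sqrt (2 / m * Real.log (((2 : ℝ) ^ a - 2) / ξ))}).toReal := by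
  subst ha
  have hm0 : m ≠ 0 := by omega
  have hm' : (0 : ℝ) < m := by positivity
  set μ := Measure.pi fun _ : Fin m => P.toMeasure
  set N : ℝ := (2 : ℝ) ^ Fintype.card 𝒜 - 2 with hN
  have hN2 : 2 ≤ N := by
    have := pow_le_pow_right₀ (one_le_two (α := ℝ)) ha2
    rw [hN]
    linarith
  have hlog : 0 ≤ Real.log (N / ξ) :=
    Real.log_nonneg ((one_le_div hξ0).2 (by linarith))
  set ε := Real.sqrt (2 / m * Real.log (N / ξ)) with hε
  have hε0 : 0 ≤ ε := Real.sqrt_nonneg _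
  have hexp : Real.exp (-(2 * m * (ε / 2) ^ 2)) = ξ / N := by
    have hsq : 2 * m * (ε / 2) ^ 2 = Real.log (N / ξ) := by
      rw [div_pow, hε, Real.sq_sqrt (by positivity)]
      field_simp
    rw [hsq, Real.exp_neg, Real.exp_log (by positivity), inv_div]
  set A : Set (Fin m → 𝒜) := {x | ∑ j, |empDist x j - (P j).toReal| ≤ ε}
  have hcover : Aᶜ ⊆ ⋃ S ∈ ({S | S ≠ ∅ ∧ S ≠ Finset.univ} : Finset (Finset 𝒜)),
      {x : Fin m → 𝒜 | ε / 2 ≤ ∑ j ∈ S, (empDist x j - (P j).toReal)} := by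
    intro x hx
    have hx : ε < ∑ j, |empDist x j - (P j).toReal| := not_le.1 hx
    obtain ⟨S, h0, h1, h2⟩ := exists_finset_half_l1_le_sum
      (fun j => empDist x j - (P j).toReal)
      (by rw [Finset.sum_sub_distrib, sum_empDist hm0, P.sum_toReal_eq_one, sub_self])
      (hε0.trans_lt hx)
    simp only [Set.mem_iUnion, Finset.mem_filter, Finset.mem_univ, true_and]
    exact ⟨S, ⟨h0, h1⟩, (div_le_div_of_nonneg_right hx.le zero_le_two).trans h2⟩
  have hbad : μ.real Aᶜ ≤ ξ := calc
    μ.real Aᶜ ≤ _ := measureReal_mono hcover (measure_ne_top _ _)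
    _ ≤ _ := measureReal_biUnion_finset_le _ _
    _ ≤ ∑ S ∈ ({S | S ≠ ∅ ∧ S ≠ Finset.univ} : Finset (Finset 𝒜)), ξ / N :=
      Finset.sum_le_sum fun S _ =>
        (measureReal_le_sum_empDist_sub_le P hm0 S (by positivity)).trans_eq hexp
    _ = ξ := by
      rw [Finset.sum_const, nsmul_eq_mul, card_filter_ne_empty_ne_univ (by omega)]
      exact mul_div_cancel₀ _ (by positivity)
  rw [probReal_compl_eq_one_sub A.toFinite.measurableSet] at hbad
  change 1 - ξ ≤ μ.real A
  linarith
end
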